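/- arXiv:1412.5655 — 2 statements merged into one kernel-verified Lean document; each statement's English description precedes it below -/
import Mathlib

section
/- There exists a universal constant C > 0 such that the following holds for all integers q ≥ 1 and n ≥ 2 and every matrix Q ∈ {−1,1}^{q×n}. Let S = Qσ ∈ ℝ^q where σ is uniform on {1,3}^n, and let T = Qν ∈ ℝ^q where ν₁,…,νₙ are independent, each equal to −1 with probability 1/10 and to 7/3 with probability 9/10. Then for every union of orthants O ⊆ ℝ^q: | Pr[S ∈ O] − Pr[T ∈ O] | ≤ C · q^{5/4} · (ln n)^{1/2} / n^{1/4}. -/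
open Finset

/-- A matrix entry of `{-1,1}` encoded by a Boolean: `false ↦ -1`, `true ↦ 1`. -/
noncomputable def pm (b : Bool) : ℝ := if b then 1 else -1

/-- The orthant of `ℝ^q` with sign pattern `s` (with `true ↦ 1`, `false ↦ -1`):
coordinates with `s i = true` are `≥ 0` and coordinates with `s i = false` are `< 0`. -/
def orthant {q : ℕ} (s : Fin q → Bool) : Set (Fin q → ℝ) :=
  {x | ∀ i, if s i then 0 ≤ x i else x i < 0}

/-- `O` is a union of orthants of `ℝ^q`. -/
def IsUnionOfOrthants {q : ℕ} (O : Set (Fin q → ℝ)) : Prop :=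
  ∃ S₀ : Finset (Fin q → Bool), O = ⋃ s ∈ S₀, orthant s

open MeasureTheory ProbabilityTheory

/-- Standard one-dimensional Gaussian. -/
noncomputable abbrev stdN : Measure ℝ := gaussianReal 0 1

/-- Dominating function for the Taylor remainder. -/
noncomputable def domD (z : ℝ) : ℝ :=
  |z| * ((|z| + 1) ^ 3 * Real.exp (|z| + 1) + |z| + 1)

lemma domD_nonneg (z : ℝ) : 0 ≤ domD z := by unfold domD; positivity

lemma integrable_exp_abs (t : ℝ) : Integrable (fun z : ℝ => Real.exp (t * |z|)) stdN :=
  integrable_exp_mul_abs (X := fun z => z) (integrable_exp_mul_gaussianReal t)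
    (integrable_exp_mul_gaussianReal (-t))

lemma abs_le_exp_abs (z : ℝ) : |z| + 1 ≤ Real.exp |z| := Real.add_one_le_exp _

lemma domD_le (z : ℝ) : domD z ≤ (Real.exp 1 + 1) * Real.exp (5 * |z|) := by
  unfold domD
  have h := abs_le_exp_abs z
  have h0 := abs_nonneg z
  set e := Real.exp |z| with he
  have h1 : 1 ≤ e := by linarith
  have h5 : Real.exp (5 * |z|) = e ^ 5 := by
    rw [he, ← Real.exp_nat_mul]; norm_num
  rw [h5, Real.exp_add]
  have he1 : 0 < Real.exp 1 := Real.exp_pos 1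
  have ha : |z| ≤ e := by linarith
  calc |z| * ((|z| + 1) ^ 3 * (e * Real.exp 1) + |z| + 1)
      = |z| * ((|z| + 1) ^ 3 * (e * Real.exp 1) + (|z| + 1)) := by ring
    _ ≤ e * (e ^ 3 * (e * Real.exp 1) + e) := by gcongr
    _ = Real.exp 1 * e ^ 5 + e ^ 2 := by ring
    _ ≤ Real.exp 1 * e ^ 5 + e ^ 5 := by
        have : e ^ 2 ≤ e ^ 5 := pow_le_pow_right₀ h1 (by norm_num)
        linarith
    _ = _ := by ring

lemma continuous_domD : Continuous domD := by unfold domD; fun_prop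

lemma integrable_domD : Integrable domD stdN := by
  refine ((integrable_exp_abs 5).const_mul (Real.exp 1 + 1)).mono'
    continuous_domD.aestronglyMeasurable (Filter.Eventually.of_forall fun z => ?_)
  rw [Real.norm_of_nonneg (domD_nonneg z)]
  exact domD_le z

lemma abs_le_domD (z : ℝ) : |z| ≤ domD z := by
  unfold domD
  have h0 := abs_nonneg z
  have : 1 ≤ (|z| + 1) ^ 3 * Real.exp (|z| + 1) + |z| + 1 := by
    have : 0 ≤ (|z| + 1) ^ 3 * Real.exp (|z| + 1) := by positivity
    linarith
  nlinarith

lemma cube_exp_ge (z : ℝ) : (|z| + 1) ^ 3 ≤ (|z| + 1) ^ 3 * Real.exp (|z| + 1) := by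
  have h0 := abs_nonneg z
  have : 1 ≤ Real.exp (|z| + 1) := Real.one_le_exp (by linarith)
  have h3 : 0 ≤ (|z| + 1) ^ 3 := by positivity
  nlinarith

lemma abs_mul_le_domD (z p : ℝ) (hp : |p| ≤ (|z| + 1) ^ 3 * Real.exp (|z| + 1) + |z| + 1) :
    |z| * |p| ≤ domD z := by
  unfold domD
  exact mul_le_mul_of_nonneg_left hp (abs_nonneg z)

lemma exp_taylor (s : ℝ) : |Real.exp s - (1 + s + s ^ 2 / 2)| ≤ |s| ^ 3 * Real.exp |s| := by
  have h := Complex.norm_exp_sub_sum_le_norm_mul_exp (s : ℂ) 3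
  simp only [Finset.sum_range_succ, Finset.sum_range_zero, Nat.factorial] at h
  have h2 : Complex.exp (s : ℂ) - (0 + (s : ℂ) ^ 0 / ((1 : ℕ) : ℂ) + (s : ℂ) ^ 1 / ((((0 + 1) * 1 : ℕ)) : ℂ)
      + (s : ℂ) ^ 2 / (((1 + 1) * ((0 + 1) * 1) : ℕ) : ℂ)) =
      ((Real.exp s - (1 + s + s ^ 2 / 2) : ℝ) : ℂ) := by
    push_cast; ring
  have h' : ‖((Real.exp s - (1 + s + s ^ 2 / 2) : ℝ) : ℂ)‖ ≤ ‖(s : ℂ)‖ ^ 3 * Real.exp ‖(s : ℂ)‖ := by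
    rw [← h2]; simpa using h
  simpa only [Complex.norm_real, Real.norm_eq_abs] using h'

lemma kernel_taylor (z w : ℝ) (hw : |w| ≤ 1) :
    |Real.exp (z * w - w ^ 2 / 2) - (1 + z * w + (z ^ 2 - 1) / 2 * w ^ 2)| ≤
      |w| ^ 3 * ((|z| + 1) ^ 3 * Real.exp (|z| + 1) + |z| + 1) := by
  set s := z * w - w ^ 2 / 2 with hs
  have h := exp_taylor s
  have hz := abs_nonneg z
  have hw0 := abs_nonneg w
  have hsabs : |s| ≤ |w| * (|z| + 1) := by
    have : |s| ≤ |z * w| + |w ^ 2 / 2| := abs_sub _ _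
    rw [abs_mul, abs_div, abs_pow] at this
    have h2 : |(2:ℝ)| = 2 := by norm_num
    rw [h2] at this
    nlinarith
  have hs1 : |s| ≤ |z| + 1 := by nlinarith
  have e1 : |s| ^ 3 * Real.exp |s| ≤ |w| ^ 3 * ((|z| + 1) ^ 3 * Real.exp (|z| + 1)) := by
    calc |s| ^ 3 * Real.exp |s| ≤ (|w| * (|z| + 1)) ^ 3 * Real.exp (|z| + 1) := by gcongr
      _ = _ := by ring
  have e2 : |s ^ 2 / 2 - w ^ 2 / 2 * z ^ 2| ≤ |w| ^ 3 * (|z| + 1) := by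
    have : s ^ 2 / 2 - w ^ 2 / 2 * z ^ 2 = w ^ 3 * (w / 8 - z / 2) := by rw [hs]; ring
    rw [this, abs_mul, abs_pow]
    have : |w / 8 - z / 2| ≤ |w / 8| + |z / 2| := abs_sub _ _
    rw [abs_div, abs_div] at this
    norm_num at this
    gcongr
    linarith
  calc _ = |(Real.exp s - (1 + s + s ^ 2 / 2)) + (s ^ 2 / 2 - w ^ 2 / 2 * z ^ 2)| := by
        congr 1; rw [hs]; ring
    _ ≤ _ := abs_add_le _ _
    _ ≤ |w| ^ 3 * ((|z| + 1) ^ 3 * Real.exp (|z| + 1)) + |w| ^ 3 * (|z| + 1) := by linarith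
    _ = _ := by ring

lemma shift_formula (f : ℝ → ℝ) (hf : Continuous f) (w : ℝ) :
    ∫ z, f (w + z) ∂stdN = ∫ z, f z * Real.exp (z * w - w ^ 2 / 2) ∂stdN := by
  have h1 : ∫ z, f (w + z) ∂stdN = ∫ z, f z ∂(gaussianReal w 1) := by
    have := gaussianReal_map_const_add (μ := 0) (v := 1) w
    rw [zero_add] at this
    rw [← this, integral_map (by fun_prop) (hf.aestronglyMeasurable)]
  rw [h1, integral_gaussianReal_eq_integral_smul one_ne_zero,
    integral_gaussianReal_eq_integral_smul one_ne_zero]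
  congr 1
  ext z
  simp only [gaussianPDFReal, smul_eq_mul, NNReal.coe_one]
  have : Real.exp (-(z - w) ^ 2 / (2 * 1)) =
      Real.exp (-(z - 0) ^ 2 / (2 * 1)) * Real.exp (z * w - w ^ 2 / 2) := by
    rw [← Real.exp_add]; congr 1; ring
  rw [this]; ring

lemma integrable_of_bdd {α : Type*} [MeasurableSpace α] {μ : Measure α} [IsFiniteMeasure μ]
    {f : α → ℝ} (hf : AEStronglyMeasurable f μ) (M : ℝ) (hb : ∀ x, |f x| ≤ M) : Integrable f μ :=
  Integrable.of_bound hf M (Filter.Eventually.of_forall hb)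

lemma taylor1 : ∃ K : ℝ, 0 < K ∧ ∀ f : ℝ → ℝ, Continuous f → (∀ x, |f x| ≤ 1) →
    ∀ L : ℝ, 0 ≤ L → (∀ x y, |f x - f y| ≤ L * |x - y|) →
    ∃ a b c : ℝ, ∀ w, |(∫ z, f (w + z) ∂stdN) - (a + b * w + c * w ^ 2)| ≤ K * L * |w| ^ 3 := by
  set K0 := ∫ z, domD z ∂stdN with hK0
  have hK0n : 0 ≤ K0 := integral_nonneg domD_nonneg
  refine ⟨1 + 3 * K0, by linarith, fun f hf hb L hL hLip => ?_⟩
  set g : ℝ → ℝ := fun z => f z - f 0 with hg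
  have hgc : Continuous g := by fun_prop
  have hgL : ∀ z, |g z| ≤ L * |z| := fun z => by simpa using hLip z 0
  -- key domination
  have key : ∀ p : ℝ → ℝ, Continuous p → ∀ M : ℝ, 0 ≤ M → (∀ z, |p z| ≤ M *
      ((|z| + 1) ^ 3 * Real.exp (|z| + 1) + |z| + 1)) →
      Integrable (fun z => g z * p z) stdN ∧ |∫ z, g z * p z ∂stdN| ≤ L * M * K0 := by
    intro p hp M hM hpM
    have hd : ∀ z, ‖g z * p z‖ ≤ L * M * domD z := by
      intro z
      rw [Real.norm_eq_abs, abs_mul]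
      calc |g z| * |p z| ≤ (L * |z|) * (M * ((|z| + 1) ^ 3 * Real.exp (|z| + 1) + |z| + 1)) := by
            gcongr
            · exact hgL z
            · exact hpM z
        _ = _ := by unfold domD; ring
    refine ⟨(integrable_domD.const_mul (L * M)).mono' (hgc.mul hp).aestronglyMeasurable
      (Filter.Eventually.of_forall hd), ?_⟩
    have := norm_integral_le_of_norm_le (integrable_domD.const_mul (L * M))
      (Filter.Eventually.of_forall hd)
    rw [integral_const_mul] at this
    simpa using this
  have pe : ∀ z : ℝ, 0 ≤ |z| ^ 3 ∧ 0 ≤ |z| ^ 2 := fun z => ⟨by positivity, by positivity⟩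
  have k1 := key (fun _ => 1) (by fun_prop) 1 zero_le_one (fun z => by
    have := cube_exp_ge z; have := abs_nonneg z; have := pe z
    rw [abs_one]; nlinarith)
  have kz := key (fun z => z) (by fun_prop) 1 zero_le_one (fun z => by
    have := cube_exp_ge z; have := abs_nonneg z; have := pe z
    nlinarith)
  have kq := key (fun z => (z ^ 2 - 1) / 2) (by fun_prop) 1 zero_le_one (fun z => by
    have h1 := cube_exp_ge z; have := abs_nonneg z; have := pe z
    have h2 : |(z ^ 2 - 1) / 2| ≤ |z| ^ 2 + 1 := by
      rw [sq_abs, abs_le]; constructor <;> nlinarith [sq_nonneg z]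
    nlinarith)
  set b := ∫ z, g z * z ∂stdN with hbdef
  set c := ∫ z, g z * ((z ^ 2 - 1) / 2) ∂stdN with hcdef
  set a0 := ∫ z, g z * 1 ∂stdN with ha0
  have hfi : ∀ w, Integrable (fun z => f (w + z)) stdN := fun w =>
    integrable_of_bdd (by fun_prop) 1 (fun z => hb _)
  have hPhi : ∀ w, ∫ z, f (w + z) ∂stdN = f 0 + ∫ z, g (w + z) ∂stdN := by
    intro w
    simp only [hg]
    rw [integral_sub (hfi w) (integrable_const _)]
    simp
  refine ⟨f 0 + a0, b, c, fun w => ?_⟩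
  have hw0 := abs_nonneg w
  by_cases hw : |w| ≤ 1
  · rw [hPhi, shift_formula g hgc]
    set R : ℝ → ℝ := fun z => Real.exp (z * w - w ^ 2 / 2) -
      (1 + z * w + (z ^ 2 - 1) / 2 * w ^ 2) with hR
    have kR := key R (by fun_prop) (|w| ^ 3) (by positivity) (fun z => kernel_taylor z w hw)
    have hsum : (fun z => g z * Real.exp (z * w - w ^ 2 / 2)) = fun z =>
        g z * R z + (g z * 1 + (g z * z * w + g z * ((z ^ 2 - 1) / 2) * w ^ 2)) := by
      ext z; simp only [hR]; ring
    have i2 : Integrable (fun z => g z * z * w + g z * ((z ^ 2 - 1) / 2) * w ^ 2) stdN :=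
      (kz.1.mul_const _).add (kq.1.mul_const _)
    have i3 : Integrable (fun z => g z * 1 +
      (g z * z * w + g z * ((z ^ 2 - 1) / 2) * w ^ 2)) stdN := k1.1.add i2
    rw [hsum, integral_add kR.1 i3, integral_add k1.1 i2, integral_add (kz.1.mul_const _) (kq.1.mul_const _), integral_mul_const w,
      integral_mul_const (w ^ 2)]
    have : f 0 + ((∫ z, g z * R z ∂stdN) + (a0 + (b * w + c * w ^ 2))) -
        (f 0 + a0 + b * w + c * w ^ 2) = ∫ z, g z * R z ∂stdN := by ring
    rw [this]
    refine kR.2.trans ?_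
    have : 0 ≤ L * |w| ^ 3 := by positivity
    nlinarith
  · push Not at hw
    have h0 : f 0 + a0 = ∫ z, f (0 + z) ∂stdN := by
      rw [hPhi 0]; simp [ha0]
    have hd : |(∫ z, f (w + z) ∂stdN) - ∫ z, f (0 + z) ∂stdN| ≤ L * |w| := by
      rw [← integral_sub (hfi w) (hfi 0)]
      have := norm_integral_le_of_norm_le_const (μ := stdN) (f := fun z => f (w + z) - f (0 + z))
        (C := L * |w|) (Filter.Eventually.of_forall fun z => by
          have := hLip (w + z) (0 + z)
          simpa using this)
      simpa using this
    have hb1 : |b * w| ≤ L * K0 * |w| := by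
      rw [abs_mul]; have := kz.2; simp only [mul_one] at this; gcongr
    have hc1 : |c * w ^ 2| ≤ L * K0 * |w| ^ 2 := by
      rw [abs_mul, abs_pow]; have := kq.2; simp only [mul_one] at this; gcongr
    have e1 : |w| ≤ |w| ^ 3 := by
      nlinarith [mul_pos (show 0 < |w| by linarith) (show 0 < |w| by linarith)]
    have e2 : |w| ^ 2 ≤ |w| ^ 3 := pow_le_pow_right₀ hw.le (by norm_num)
    rw [h0]
    calc _ = |((∫ z, f (w + z) ∂stdN) - ∫ z, f (0 + z) ∂stdN) - b * w - c * w ^ 2| := by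
          congr 1; ring
      _ ≤ L * |w| + L * K0 * |w| + L * K0 * |w| ^ 2 := by
          refine (abs_sub _ _).trans ?_
          refine add_le_add ((abs_sub _ _).trans (add_le_add hd hb1)) hc1
      _ ≤ L * |w| ^ 3 + L * K0 * |w| ^ 3 + L * K0 * |w| ^ 3 := by gcongr
      _ ≤ _ := by
        have : 0 ≤ L * K0 * |w| ^ 3 := by positivity
        nlinarith

lemma integrable_of_le_domD {p : ℝ → ℝ} (hp : Continuous p) (h : ∀ z, |p z| ≤ domD z) :
    Integrable p stdN :=
  integrable_domD.mono' hp.aestronglyMeasurable (Filter.Eventually.of_forall h)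

lemma integrable_cube : Integrable (fun z : ℝ => |z| ^ 3) stdN :=
  integrable_of_le_domD (by fun_prop) fun z => by
    have h1 := cube_exp_ge z
    have h0 := abs_nonneg z
    have : |z| * |(z ^ 2)| ≤ domD z := abs_mul_le_domD z _ (by
      rw [abs_pow]; nlinarith [pow_nonneg h0 3, pow_nonneg h0 2])
    rw [abs_pow, abs_abs]
    calc |z| ^ 3 = |z| * |z ^ 2| := by rw [abs_pow]; ring
      _ ≤ _ := this

lemma integrable_absz : Integrable (fun z : ℝ => |z|) stdN :=
  integrable_of_le_domD (by fun_prop) fun z => by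
    rw [abs_abs]; exact abs_le_domD z

lemma integrable_z : Integrable (fun z : ℝ => z) stdN :=
  integrable_of_le_domD (by fun_prop) abs_le_domD

lemma integrable_sq : Integrable (fun z : ℝ => z ^ 2) stdN :=
  (memLp_id_gaussianReal 2).integrable_sq

lemma integral_z : ∫ z : ℝ, z ∂stdN = 0 := integral_id_gaussianReal

lemma integral_sq : ∫ z : ℝ, z ^ 2 ∂stdN = 1 := by
  have h := variance_id_gaussianReal (μ := 0) (v := 1)
  rw [variance_of_integral_eq_zero aemeasurable_id integral_id_gaussianReal] at h
  simpa using h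

/-- Two-point distribution with mean zero, variance one, bounded by three. -/
structure TwoPt (w ξ : Bool → ℝ) : Prop where
  nonneg : ∀ b, 0 ≤ w b
  sum : w true + w false = 1
  mean : w true * ξ true + w false * ξ false = 0
  var : w true * ξ true ^ 2 + w false * ξ false ^ 2 = 1
  bdd : ∀ b, |ξ b| ≤ 3

lemma step1D : ∃ K : ℝ, 0 < K ∧ ∀ w ξ : Bool → ℝ, TwoPt w ξ → ∀ f : ℝ → ℝ, Continuous f →
    (∀ x, |f x| ≤ 1) → ∀ L : ℝ, 0 ≤ L → (∀ x y, |f x - f y| ≤ L * |x - y|) → ∀ t : ℝ, 0 < t →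
    |w true * (∫ z, f (ξ true + t * z) ∂stdN) + w false * (∫ z, f (ξ false + t * z) ∂stdN)
      - ∫ u, ∫ z, f (u + t * z) ∂stdN ∂stdN| ≤ K * L * min 1 (1 / t ^ 2) := by
  obtain ⟨K0, hK0, hT⟩ := taylor1
  set m1 := ∫ z : ℝ, |z| ∂stdN with hm1
  set m3 := ∫ z : ℝ, |z| ^ 3 ∂stdN with hm3
  have m1n : 0 ≤ m1 := integral_nonneg fun z => abs_nonneg z
  have m3n : 0 ≤ m3 := integral_nonneg fun z => by positivity
  refine ⟨K0 * (27 + m3) + (3 + m1), by positivity, ?_⟩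
  intro w ξ hw f hf hb L hL hLip t ht
  set φ : ℝ → ℝ := fun u => ∫ z, f (u + t * z) ∂stdN with hφ
  have hfi : ∀ u, Integrable (fun z => f (u + t * z)) stdN := fun u =>
    integrable_of_bdd (by fun_prop) 1 (fun z => hb _)
  have φlip : ∀ u u', |φ u - φ u'| ≤ L * |u - u'| := by
    intro u u'
    simp only [hφ]
    rw [← integral_sub (hfi u) (hfi u')]
    have := norm_integral_le_of_norm_le_const (μ := stdN)
      (f := fun z => f (u + t * z) - f (u' + t * z))
      (C := L * |u - u'|) (Filter.Eventually.of_forall fun z => by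
        have := hLip (u + t * z) (u' + t * z)
        simpa using this)
    simpa using this
  have φc : Continuous φ := by
    have : LipschitzWith (Real.toNNReal L) φ := LipschitzWith.of_dist_le_mul fun x y => by
      rw [Real.dist_eq, Real.dist_eq, Real.coe_toNNReal L hL]; exact φlip x y
    exact this.continuous
  have φb : ∀ u, |φ u| ≤ 1 := by
    intro u
    have := norm_integral_le_of_norm_le_const (μ := stdN) (f := fun z => f (u + t * z))
      (C := 1) (Filter.Eventually.of_forall fun z => hb _)
    simpa using this
  have φi : Integrable φ stdN := integrable_of_bdd φc.aestronglyMeasurable 1 φb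
  -- general comparison
  have gen : ∀ a b c M : ℝ, 0 ≤ M → ∀ e : ℝ → ℝ, Continuous e → (∀ u, 0 ≤ e u) →
      Integrable e stdN → (∀ u, |φ u - (a + b * u + c * u ^ 2)| ≤ M * e u) → ∀ E, 
      e (ξ true) ≤ E → e (ξ false) ≤ E → 
      |w true * φ (ξ true) + w false * φ (ξ false) - ∫ u, φ u ∂stdN| ≤
        M * (E + ∫ u, e u ∂stdN) := by
    intro a b c M hM e hec he hei hP E hE1 hE2
    have ipoly : Integrable (fun u : ℝ => a + b * u + c * u ^ 2) stdN :=
      ((integrable_const a).add (integrable_z.const_mul b)).add (integrable_sq.const_mul c)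
    have hint : ∫ u : ℝ, (a + b * u + c * u ^ 2) ∂stdN = a + c := by
      have i1 : Integrable (fun u : ℝ => a + b * u) stdN :=
        (integrable_const a).add (integrable_z.const_mul b)
      rw [integral_add i1 (integrable_sq.const_mul c),
        integral_add (integrable_const a) (integrable_z.const_mul b), integral_const_mul,
        integral_const_mul, integral_z, integral_sq]
      simp
    have h3 : |∫ u, (φ u - (a + b * u + c * u ^ 2)) ∂stdN| ≤ M * ∫ u, e u ∂stdN := by
      rw [← integral_const_mul]
      exact norm_integral_le_of_norm_le (f := fun u => φ u - (a + b * u + c * u ^ 2))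
        (hei.const_mul M) (Filter.Eventually.of_forall hP)
    rw [integral_sub φi ipoly, hint] at h3
    have q1 := abs_le.mp (hP (ξ true))
    have q2 := abs_le.mp (hP (ξ false))
    have q3 := abs_le.mp h3
    have w1 := hw.nonneg true
    have w2 := hw.nonneg false
    have b1 : M * e (ξ true) ≤ M * E := by gcongr
    have b2 : M * e (ξ false) ≤ M * E := by gcongr
    have hs := hw.sum
    have hm := hw.mean
    have hv := hw.var
    have eqn : w true * φ (ξ true) + w false * φ (ξ false) - ∫ u, φ u ∂stdN =
      w true * (φ (ξ true) - (a + b * ξ true + c * ξ true ^ 2)) +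
      w false * (φ (ξ false) - (a + b * ξ false + c * ξ false ^ 2)) -
      ((∫ u, φ u ∂stdN) - (a + c)) := by
      linear_combination a * hs + b * hm + c * hv
    rw [eqn]
    have c1 : |w true * (φ (ξ true) - (a + b * ξ true + c * ξ true ^ 2))| ≤ w true * (M * E) := by
      rw [abs_mul, abs_of_nonneg w1]
      exact mul_le_mul_of_nonneg_left ((hP _).trans b1) w1
    have c2 : |w false * (φ (ξ false) - (a + b * ξ false + c * ξ false ^ 2))| ≤
        w false * (M * E) := by
      rw [abs_mul, abs_of_nonneg w2]
      exact mul_le_mul_of_nonneg_left ((hP _).trans b2) w2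
    refine (abs_sub _ _).trans ((add_le_add ((abs_add_le _ _).trans (add_le_add c1 c2)) h3).trans ?_)
    have : w true * (M * E) + w false * (M * E) = M * E := by
      linear_combination (M * E) * hs
    linarith
  have B1 := gen (φ 0) 0 0 L hL (fun u => |u|) (by fun_prop) (fun u => abs_nonneg u)
    integrable_absz (fun u => by simpa using φlip u 0) 3 (hw.bdd true) (hw.bdd false)
  obtain ⟨a, b, c, habc⟩ := hT (fun y => f (t * y)) (by fun_prop) (fun x => hb _) (L * t)
    (by positivity) (fun x y => by
      have := hLip (t * x) (t * y)
      rw [← mul_sub, abs_mul, abs_of_pos ht] at this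
      linarith)
  have cube3 : ∀ b, |ξ b| ^ 3 ≤ 27 := fun b => by
    have := pow_le_pow_left₀ (abs_nonneg (ξ b)) (hw.bdd b) 3
    norm_num at this; exact this
  have B2 := gen a (b / t) (c / t ^ 2) (K0 * L / t ^ 2) (by positivity) (fun u => |u| ^ 3)
    (by fun_prop) (fun u => by positivity) integrable_cube (fun u => by
      have h := habc (u / t)
      have e1 : (∫ z, f (t * (u / t + z)) ∂stdN) = φ u := by
        simp only [hφ]
        congr 1; ext z; congr 1; field_simp
      rw [e1] at h
      have e2 : a + b * (u / t) + c * (u / t) ^ 2 = a + b / t * u + c / t ^ 2 * u ^ 2 := by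
        field_simp
      have e3 : K0 * (L * t) * |u / t| ^ 3 = K0 * L / t ^ 2 * |u| ^ 3 := by
        rw [abs_div, abs_of_pos ht]; field_simp
      rwa [e2, e3] at h) 27 (cube3 true) (cube3 false)
  rw [← hm1] at B1
  rw [← hm3] at B2
  have hLK : 0 ≤ L * (K0 * (27 + m3)) := by positivity
  have hLK' : 0 ≤ L * (3 + m1) := by positivity
  rcases min_choice (1:ℝ) (1 / t ^ 2) with h | h
  · rw [h]
    refine B1.trans ?_
    linarith
  · rw [h]
    refine B2.trans ?_
    have : K0 * L / t ^ 2 * (27 + m3) = (L * (K0 * (27 + m3))) * (1 / t ^ 2) := by ring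
    rw [this]
    have ht2 : 0 ≤ 1 / t ^ 2 := by positivity
    have : 0 ≤ L * (3 + m1) * (1 / t ^ 2) := by positivity
    linarith

/-- Euclidean space used for the Gaussian comparison. -/
abbrev Eu (q : ℕ) := EuclideanSpace ℝ (Fin q)

/-- Centered Gaussian with covariance `A`. -/
noncomputable abbrev gam {q : ℕ} (A : Matrix (Fin q) (Fin q) ℝ) : Measure (Eu q) :=
  multivariateGaussian 0 A

/-- Rank one matrix. -/
def rk1 {q : ℕ} (v : Eu q) : Matrix (Fin q) (Fin q) ℝ := Matrix.vecMulVec v v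

lemma rk1_posSemidef {q : ℕ} (v : Eu q) : (rk1 v).PosSemidef := by
  have := Matrix.posSemidef_vecMulVec_self_star (fun i => v i)
  simpa [rk1] using this

lemma rk1_quad {q : ℕ} (v : Eu q) (x : Fin q → ℝ) :
    x ⬝ᵥ (rk1 v).mulVec x = (x ⬝ᵥ (fun i => v i)) ^ 2 := by
  rw [rk1, Matrix.vecMulVec_mulVec, sq]
  rw [dotProduct_comm (fun i => v i) x]
  simp [dotProduct_smul]

lemma gam_conv {q : ℕ} (S : Matrix (Fin q) (Fin q) ℝ) (hS : S.PosSemidef) (v : Eu q) (t : ℝ) :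
    gam (S + t ^ 2 • rk1 v) = (stdN.map (fun z => (t * z) • v)) ∗ gam S := by
  have : IsProbabilityMeasure (stdN.map (fun z : ℝ => (t * z) • v)) :=
    Measure.isProbabilityMeasure_map (by fun_prop)
  apply Measure.ext_of_charFun
  ext x
  have hS' : (S + t ^ 2 • rk1 v).PosSemidef := hS.add ((rk1_posSemidef v).smul (sq_nonneg t))
  rw [charFun_conv, charFun_multivariateGaussian hS', charFun_multivariateGaussian hS]
  have h1 : charFun (stdN.map (fun z : ℝ => (t * z) • v)) x =
      charFun stdN (t * inner ℝ v x) := by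
    rw [charFun_apply, charFun_apply, integral_map (by fun_prop) (by fun_prop)]
    congr 1; ext z
    congr 2
    rw [inner_smul_left]
    simp
    ring
  rw [h1, charFun_gaussianReal, ← Complex.exp_add]
  congr 1
  have h2 : (x ⬝ᵥ (S + t ^ 2 • rk1 v).mulVec x) = x ⬝ᵥ S.mulVec x + (t * inner ℝ v x) ^ 2 := by
    rw [Matrix.add_mulVec, Matrix.smul_mulVec, dotProduct_add, dotProduct_smul, rk1_quad]
    have : inner ℝ v x = (fun i => x i) ⬝ᵥ (fun i => v i) := by
      simp [PiLp.inner_apply, dotProduct]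
    rw [this, smul_eq_mul, mul_pow]
  rw [h2]
  simp
  ring

lemma cont_smooth {q : ℕ} (μ : Measure (Eu q)) [IsProbabilityMeasure μ] (h : Eu q → ℝ)
    (hc : Continuous h) (hb : ∀ x, |h x| ≤ 1) : Continuous fun x => ∫ y, h (x + y) ∂μ := by
  refine continuous_of_dominated (bound := fun _ => 1) (fun x => by fun_prop) (fun x => ?_)
    (integrable_const _) ?_
  · exact Filter.Eventually.of_forall fun y => hb _
  · exact Filter.Eventually.of_forall fun y => by fun_prop

lemma gam_conv_int {q : ℕ} (S : Matrix (Fin q) (Fin q) ℝ) (hS : S.PosSemidef) (v : Eu q) (t : ℝ)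
    (h : Eu q → ℝ) (hc : Continuous h) (hb : ∀ x, |h x| ≤ 1) (x : Eu q) :
    ∫ y, h (x + y) ∂gam (S + t ^ 2 • rk1 v) =
      ∫ z, ∫ y, h (x + (t * z) • v + y) ∂gam S ∂stdN := by
  have : IsProbabilityMeasure (stdN.map (fun z : ℝ => (t * z) • v)) :=
    Measure.isProbabilityMeasure_map (by fun_prop)
  rw [gam_conv S hS, integral_conv (integrable_of_bdd (by fun_prop) 1 (fun y => hb _)),
    integral_map (by fun_prop)]
  · simp only [add_assoc]
  · have := (cont_smooth (gam S) (fun y => h (x + y)) (by fun_prop) (fun y => hb _))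
    exact this.aestronglyMeasurable

/-- Leverage of `v` with respect to `A`. -/
noncomputable def lev {q : ℕ} (A : Matrix (Fin q) (Fin q) ℝ) (v : Eu q) : ℝ :=
  (fun i => v i) ⬝ᵥ (A⁻¹).mulVec (fun i => v i)

lemma lev_pos {q : ℕ} {A : Matrix (Fin q) (Fin q) ℝ} (hA : A.PosDef) {v : Eu q} (hv : v ≠ 0) :
    0 < lev A v := by
  have := hA.inv.dotProduct_mulVec_pos (x := fun i => v i) (fun h => hv (by
    ext i; exact congrFun h i))
  simpa [lev] using this

lemma sub_posSemidef {q : ℕ} {A : Matrix (Fin q) (Fin q) ℝ} (hA : A.PosDef) {v : Eu q}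
    (hv : v ≠ 0) : (A - (lev A v)⁻¹ • rk1 v).PosSemidef := by
  have hρ := lev_pos hA hv
  set ρ := lev A v with hρd
  refine Matrix.PosSemidef.of_dotProduct_mulVec_nonneg
    (hA.isHermitian.sub (((rk1_posSemidef v).smul (inv_nonneg.mpr hρ.le)).isHermitian)) fun x => ?_
  rw [star_trivial, Matrix.sub_mulVec, Matrix.smul_mulVec, dotProduct_sub, dotProduct_smul,
    rk1_quad]
  set vv : Fin q → ℝ := fun i => v i with hvv
  set w := (A⁻¹).mulVec vv with hw
  have hAw : A.mulVec w = vv := by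
    rw [hw, Matrix.mulVec_mulVec, Matrix.mul_nonsing_inv _ ((Matrix.isUnit_iff_isUnit_det A).mp hA.isUnit),
      Matrix.one_mulVec]
  set c := (x ⬝ᵥ vv) / ρ with hc
  have hq := hA.posSemidef.dotProduct_mulVec_nonneg (x - c • w)
  rw [star_trivial, Matrix.mulVec_sub, Matrix.mulVec_smul, hAw, sub_dotProduct, dotProduct_sub,
    dotProduct_sub, dotProduct_smul, smul_dotProduct, smul_dotProduct, dotProduct_smul] at hq
  have hsym : w ⬝ᵥ A.mulVec x = x ⬝ᵥ vv := by
    rw [Matrix.dotProduct_mulVec, ← hAw, dotProduct_comm x, ← Matrix.mulVec_transpose]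
    have : A.transpose = A := by
      have := hA.isHermitian; rwa [Matrix.IsHermitian, Matrix.conjTranspose_eq_transpose_of_trivial] at this
    rw [this]
  have hwv : w ⬝ᵥ vv = ρ := by rw [dotProduct_comm]; rfl
  rw [hsym, hwv] at hq
  simp only [smul_eq_mul] at hq ⊢
  have h1 : c * ρ = x ⬝ᵥ vv := by rw [hc]; field_simp
  have h2 : ρ⁻¹ * (x ⬝ᵥ vv) ^ 2 = c * (x ⬝ᵥ vv) := by rw [hc]; field_simp
  rw [h2]
  rw [h1] at hq
  linarith

lemma det_update {q : ℕ} {A : Matrix (Fin q) (Fin q) ℝ} (hA : A.PosDef) (v : Eu q) :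
    (A + rk1 v).det = A.det * (1 + lev A v) := by
  have h := Matrix.det_add_replicateCol_mul_replicateRow (ι := Unit)
    ((Matrix.isUnit_iff_isUnit_det A).mp hA.isUnit) (fun i => v i) (fun i => v i)
  rw [← Matrix.vecMulVec_eq] at h
  rw [rk1, h]
  congr 1
  rw [Matrix.det_unique]
  simp [lev, Matrix.mul_apply, dotProduct, Matrix.mulVec, Finset.sum_mul, Finset.mul_sum]
  rw [Finset.sum_comm]
  refine Finset.sum_congr rfl fun i _ => Finset.sum_congr rfl fun j _ => by ring

lemma min_le_log (x : ℝ) (hx : 0 ≤ x) : min 1 x ≤ 2 * Real.log (1 + x) := by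
  have key : ∀ y : ℝ, 0 ≤ y → y ≤ 1 → y ≤ 2 * Real.log (1 + y) := by
    intro y h0 h1
    have := Real.one_sub_inv_le_log_of_pos (show 0 < 1 + y by linarith)
    have h2 : y / 2 ≤ 1 - (1 + y)⁻¹ := by
      have : 1 - (1 + y)⁻¹ = y / (1 + y) := by field_simp; ring
      rw [this]
      gcongr; linarith
    linarith
  rcases le_total x 1 with h | h
  · rw [min_eq_right h]; exact key x hx h
  · rw [min_eq_left h]
    have h1 := key 1 zero_le_one le_rfl
    have : Real.log (1 + 1) ≤ Real.log (1 + x) := Real.log_le_log (by norm_num) (by linarith)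
    linarith

lemma step_multi : ∃ K : ℝ, 0 < K ∧ ∀ w ξ : Bool → ℝ, TwoPt w ξ → ∀ (q : ℕ) (h : Eu q → ℝ),
    Continuous h → (∀ x, |h x| ≤ 1) → ∀ L : ℝ, 0 ≤ L → ∀ v : Eu q, v ≠ 0 →
    (∀ x c, |h (x + c • v) - h x| ≤ L * |c|) → ∀ A : Matrix (Fin q) (Fin q) ℝ, A.PosDef →
    ∀ x, |w true * (∫ y, h (x + ξ true • v + y) ∂gam A) +
      w false * (∫ y, h (x + ξ false • v + y) ∂gam A) - ∫ y, h (x + y) ∂gam (A + rk1 v)| ≤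
      K * L * (Real.log (A + rk1 v).det - Real.log A.det) := by
  obtain ⟨K, hK, hstep⟩ := step1D
  refine ⟨2 * K, by positivity, ?_⟩
  intro w ξ hw q h hc hb L hL v hv hLip A hA x
  have hρ := lev_pos hA hv
  set ρ := lev A v with hρd
  set B := A - ρ⁻¹ • rk1 v with hB
  have hBp : B.PosSemidef := sub_posSemidef hA hv
  set t := Real.sqrt ρ⁻¹ with ht
  have htp : 0 < t := Real.sqrt_pos.mpr (inv_pos.mpr hρ)
  have ht2 : t ^ 2 = ρ⁻¹ := Real.sq_sqrt (inv_nonneg.mpr hρ.le)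
  have hAB : A = B + t ^ 2 • rk1 v := by rw [ht2, hB]; simp
  set f : ℝ → ℝ := fun u => ∫ y, h (x + u • v + y) ∂gam B with hf
  have hfA : ∀ u, ∫ y, h (x + u • v + y) ∂gam A = ∫ z, f (u + t * z) ∂stdN := by
    intro u
    rw [hAB, gam_conv_int B hBp v t h hc hb]
    simp only [hf, add_smul, add_assoc]
  have hlast : ∫ y, h (x + y) ∂gam (A + rk1 v) = ∫ u, ∫ z, f (u + t * z) ∂stdN ∂stdN := by
    have := gam_conv_int A hA.posSemidef v 1 h hc hb x
    rw [one_pow, one_smul] at this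
    rw [this]
    simp only [one_mul, hfA]
  have hfc : Continuous f := by
    have := (cont_smooth (gam B) h hc hb).comp (show Continuous (fun u : ℝ => x + u • v) by fun_prop)
    exact this
  have hfb : ∀ u, |f u| ≤ 1 := by
    intro u
    have := norm_integral_le_of_norm_le_const (μ := gam B) (f := fun y => h (x + u • v + y))
      (C := 1) (Filter.Eventually.of_forall fun z => hb _)
    simpa using this
  have hfl : ∀ u u', |f u - f u'| ≤ L * |u - u'| := by
    intro u u'
    have hi : ∀ u : ℝ, Integrable (fun y => h (x + u • v + y)) (gam B) := fun u =>
      integrable_of_bdd (by fun_prop) 1 (fun z => hb _)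
    simp only [hf]
    rw [← integral_sub (hi u) (hi u')]
    have := norm_integral_le_of_norm_le_const (μ := gam B)
      (f := fun y => h (x + u • v + y) - h (x + u' • v + y))
      (C := L * |u - u'|) (Filter.Eventually.of_forall fun y => by
        have := hLip (x + u' • v + y) (u - u')
        have e : x + u' • v + y + (u - u') • v = x + u • v + y := by
          rw [sub_smul]; abel
        rw [e] at this
        exact this)
    simpa using this
  rw [hfA, hfA, hlast]
  refine (hstep w ξ hw f hfc hfb L hL hfl t htp).trans ?_
  rw [ht2, det_update hA, Real.log_mul hA.det_pos.ne' (by rw [← hρd]; positivity), ← hρd]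
  have := min_le_log ρ hρ.le
  rw [one_div, inv_inv]
  have hKL : 0 ≤ K * L := by positivity
  nlinarith

/-- Expectation over independent two-point variables with weights `w`. -/
noncomputable def Ex (w : Bool → ℝ) (n : ℕ) (F : (Fin n → Bool) → ℝ) : ℝ :=
  ∑ b : Fin n → Bool, (∏ j, w (b j)) * F b

lemma Ex_succ (w : Bool → ℝ) (n : ℕ) (F : (Fin (n + 1) → Bool) → ℝ) :
    Ex w (n + 1) F = w true * Ex w n (fun b => F (Fin.cons true b)) +
      w false * Ex w n (fun b => F (Fin.cons false b)) := by
  unfold Ex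
  rw [← (Fin.consEquiv (fun _ => Bool)).sum_comp, Fintype.sum_prod_type, Fintype.sum_bool,
    Finset.mul_sum, Finset.mul_sum]
  congr 1 <;> refine Finset.sum_congr rfl fun b _ => ?_ <;>
    simp [Fin.consEquiv, Fin.prod_univ_succ, mul_assoc]

lemma Ex_sum_one (w : Bool → ℝ) (hs : w true + w false = 1) (n : ℕ) :
    Ex w n (fun _ => 1) = 1 := by
  induction n with
  | zero => simp [Ex]
  | succ n ih => rw [Ex_succ, ih]; linarith

lemma Ex_mono (w : Bool → ℝ) (hw : ∀ b, 0 ≤ w b) (n : ℕ) (F G : (Fin n → Bool) → ℝ)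
    (h : ∀ b, F b ≤ G b) : Ex w n F ≤ Ex w n G :=
  Finset.sum_le_sum fun b _ => mul_le_mul_of_nonneg_left (h b)
    (Finset.prod_nonneg fun j _ => hw _)

lemma Ex_add (w : Bool → ℝ) (n : ℕ) (F G : (Fin n → Bool) → ℝ) :
    Ex w n (fun b => F b + G b) = Ex w n F + Ex w n G := by
  simp [Ex, mul_add, Finset.sum_add_distrib]

lemma Ex_sum {ι : Type*} (s : Finset ι) (w : Bool → ℝ) (n : ℕ) (F : ι → (Fin n → Bool) → ℝ) :
    Ex w n (fun b => ∑ i ∈ s, F i b) = ∑ i ∈ s, Ex w n (F i) := by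
  simp only [Ex, Finset.mul_sum]
  rw [Finset.sum_comm]

lemma Ex_const (w : Bool → ℝ) (hs : w true + w false = 1) (n : ℕ) (c : ℝ) :
    Ex w n (fun _ => c) = c := by
  have := Ex_sum_one w hs n
  simp only [Ex, mul_one] at this
  simp [Ex, ← Finset.sum_mul, this]

lemma Ex_close (w : Bool → ℝ) (hw : ∀ b, 0 ≤ w b) (hs : w true + w false = 1) (n : ℕ)
    (F G : (Fin n → Bool) → ℝ) (ε : ℝ)
    (h : ∀ b, |F b - G b| ≤ ε) : |Ex w n F - Ex w n G| ≤ ε := by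
  have h1 := Ex_mono w hw n F (fun b => G b + ε) (fun b => by linarith [(abs_le.mp (h b)).2])
  have h2 := Ex_mono w hw n G (fun b => F b + ε) (fun b => by linarith [(abs_le.mp (h b)).1])
  rw [Ex_add, Ex_const w hs] at h1 h2
  rw [abs_le]; constructor <;> linarith

lemma lindeberg : ∃ K : ℝ, 0 < K ∧ ∀ w ξ : Bool → ℝ, TwoPt w ξ → ∀ (q : ℕ) (h : Eu q → ℝ),
    Continuous h → (∀ x, |h x| ≤ 1) → ∀ L : ℝ, 0 ≤ L → ∀ (n : ℕ) (v : Fin n → Eu q),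
    (∀ j, v j ≠ 0) → (∀ j (x : Eu q) (c : ℝ), |h (x + c • v j) - h x| ≤ L * |c|) → ∀ x : Eu q,
    |Ex w n (fun b => ∫ y, h (x + (∑ j, ξ (b j) • v j) + y) ∂gam 1) -
      ∫ y, h (x + y) ∂gam (1 + ∑ j, rk1 (v j))| ≤
      K * L * Real.log (1 + ∑ j, rk1 (v j)).det := by
  obtain ⟨K, hK, hstep⟩ := step_multi
  refine ⟨K, hK, ?_⟩
  intro w ξ hw q h hc hb L hL n
  induction n with
  | zero => intro v hv hl x; simp [Ex]
  | succ n ih =>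
    intro v hv hl x
    set A : Matrix (Fin q) (Fin q) ℝ := 1 + ∑ j : Fin n, rk1 (v j.succ) with hA
    have hAp : A.PosDef := Matrix.PosDef.one.add_posSemidef
      (Matrix.posSemidef_sum _ fun j _ => rk1_posSemidef _)
    have hA' : 1 + ∑ j, rk1 (v j) = A + rk1 (v 0) := by
      rw [Fin.sum_univ_succ, hA]; abel
    rw [hA', Ex_succ]
    have hs := hstep w ξ hw q h hc hb L hL (v 0) (hv 0) (hl 0) A hAp x
    have hI : ∀ b0 : Bool, |Ex w n (fun b => ∫ y, h (x + (∑ j, ξ ((Fin.cons b0 b :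
        Fin (n + 1) → Bool) j) • v j) + y) ∂gam 1) - ∫ y, h (x + ξ b0 • v 0 + y) ∂gam A| ≤
        K * L * Real.log A.det := by
      intro b0
      have := ih (fun j => v j.succ) (fun j => hv _) (fun j => hl _) (x + ξ b0 • v 0)
      simp only [Fin.sum_univ_succ, Fin.cons_zero, Fin.cons_succ]
      simp only [← add_assoc]
      exact this
    have h1 := hI true
    have h2 := hI false
    have w1 := hw.nonneg true
    have w2 := hw.nonneg false
    have hsum := hw.sum
    set X1 := Ex w n (fun b => ∫ y, h (x + (∑ j, ξ ((Fin.cons true b :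
        Fin (n + 1) → Bool) j) • v j) + y) ∂gam 1)
    set X2 := Ex w n (fun b => ∫ y, h (x + (∑ j, ξ ((Fin.cons false b :
        Fin (n + 1) → Bool) j) • v j) + y) ∂gam 1)
    set Y1 := ∫ y, h (x + ξ true • v 0 + y) ∂gam A
    set Y2 := ∫ y, h (x + ξ false • v 0 + y) ∂gam A
    set Z := ∫ y, h (x + y) ∂gam (A + rk1 (v 0))
    have c1 : |w true * (X1 - Y1)| ≤ w true * (K * L * Real.log A.det) := by
      rw [abs_mul, abs_of_nonneg w1]; exact mul_le_mul_of_nonneg_left h1 w1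
    have c2 : |w false * (X2 - Y2)| ≤ w false * (K * L * Real.log A.det) := by
      rw [abs_mul, abs_of_nonneg w2]; exact mul_le_mul_of_nonneg_left h2 w2
    have e : w true * X1 + w false * X2 - Z =
      (w true * (X1 - Y1) + w false * (X2 - Y2)) + (w true * Y1 + w false * Y2 - Z) := by ring
    rw [e]
    refine (abs_add_le _ _).trans
      ((add_le_add ((abs_add_le _ _).trans (add_le_add c1 c2)) hs).trans (le_of_eq ?_))
    linear_combination (K * L * Real.log A.det) * hsum

lemma det_bound {q n : ℕ} (v : Fin n → Eu q) (hv : ∀ j i, |v j i| ≤ 1) :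
    Real.log (1 + ∑ j, rk1 (v j)).det ≤ q * Real.log (q * (n + 1)) := by
  set A : Matrix (Fin q) (Fin q) ℝ := 1 + ∑ j, rk1 (v j) with hA
  have hAp : A.PosDef := Matrix.PosDef.one.add_posSemidef
      (Matrix.posSemidef_sum _ fun j _ => rk1_posSemidef _)
  have hent : ∀ i k, (AbsoluteValue.abs : AbsoluteValue ℝ ℝ) (A i k) ≤ (n : ℝ) + 1 := by
    intro i k
    rw [AbsoluteValue.abs_apply, hA, Matrix.add_apply, Matrix.sum_apply]
    refine (abs_add_le _ _).trans ?_
    have h1 : |(1 : Matrix (Fin q) (Fin q) ℝ) i k| ≤ 1 := by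
      rw [Matrix.one_apply]; split_ifs <;> simp
    have h2 : |∑ j, rk1 (v j) i k| ≤ n := by
      refine (Finset.abs_sum_le_sum_abs _ _).trans ?_
      refine (Finset.sum_le_sum (g := fun _ => (1:ℝ)) fun j _ => ?_).trans (by simp)
      rw [rk1, Matrix.vecMulVec_apply, abs_mul]
      exact mul_le_one₀ (hv j i) (abs_nonneg _) (hv j k)
    linarith
  have hd := Matrix.det_le hent
  rw [AbsoluteValue.abs_apply, abs_of_pos hAp.det_pos, Fintype.card_fin, nsmul_eq_mul] at hd
  have hf : ((q.factorial : ℕ) : ℝ) ≤ (q : ℝ) ^ q := by exact_mod_cast Nat.factorial_le_pow q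
  have : A.det ≤ ((q : ℝ) * (n + 1)) ^ q := by
    rw [mul_pow]
    exact hd.trans (by gcongr)
  calc Real.log A.det ≤ Real.log (((q : ℝ) * (n + 1)) ^ q) := Real.log_le_log hAp.det_pos this
    _ = _ := by rw [Real.log_pow]

lemma smooth_cost {q : ℕ} (h : Eu q → ℝ) (hc : Continuous h) (hb : ∀ x, |h x| ≤ 1) (L : ℝ)
    (hL : 0 ≤ L) (hl : ∀ (x y : Eu q) (M : ℝ), (∀ i, |y i| ≤ M) → |h (x + y) - h x| ≤ L * M) (x : Eu q) :
    |h x - ∫ y, h (x + y) ∂gam (1 : Matrix (Fin q) (Fin q) ℝ)| ≤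
      L * (q * ∫ z : ℝ, |z| ∂stdN) := by
  have hmp : ∀ i : Fin q, MeasurePreserving (fun y : Eu q => y i)
      (gam (1 : Matrix (Fin q) (Fin q) ℝ)) stdN := by
    intro i
    have := measurePreserving_eval_multivariateGaussian (μ := (0 : Eu q))
      (S := (1 : Matrix (Fin q) (Fin q) ℝ)) Matrix.PosSemidef.one (i := i)
    simpa using this
  have hint : ∀ i : Fin q, Integrable (fun y : Eu q => |y i|)
      (gam (1 : Matrix (Fin q) (Fin q) ℝ)) := fun i =>
    ((hmp i).integrable_comp (g := fun z : ℝ => |z|) (by fun_prop)).mpr integrable_absz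
  have hval : ∀ i : Fin q, ∫ y : Eu q, |y i| ∂gam (1 : Matrix (Fin q) (Fin q) ℝ) =
      ∫ z : ℝ, |z| ∂stdN := fun i => by
    rw [← (hmp i).map_eq, integral_map (by fun_prop) (by fun_prop)]
  have hS : Integrable (fun y : Eu q => L * ∑ i, |y i|) (gam (1 : Matrix (Fin q) (Fin q) ℝ)) :=
    (integrable_finsetSum _ fun i _ => hint i).const_mul L
  have hd : ∀ y : Eu q, ‖h (x + y) - h x‖ ≤ L * ∑ i, |y i| := fun y => by
    exact hl x y _ fun i => Finset.single_le_sum (f := fun i => |y i|)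
      (fun _ _ => abs_nonneg _) (Finset.mem_univ i)
  have := norm_integral_le_of_norm_le hS (Filter.Eventually.of_forall hd)
  rw [integral_const_mul, integral_finsetSum _ fun i _ => hint i,
    integral_sub (integrable_of_bdd (by fun_prop) 1 (fun z => hb _)) (integrable_const _)] at this
  simp only [hval, Finset.sum_const, Finset.card_univ, Fintype.card_fin, nsmul_eq_mul,
    integral_const, probReal_univ, one_smul] at this
  rw [abs_sub_comm]
  exact this

lemma wass : ∃ K : ℝ, 0 < K ∧ ∀ w ξ w' ξ' : Bool → ℝ, TwoPt w ξ → TwoPt w' ξ' →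
    ∀ (q n : ℕ), 1 ≤ q → ∀ (h : Eu q → ℝ),
    Continuous h → (∀ x, |h x| ≤ 1) → ∀ L : ℝ, 0 ≤ L →
    (∀ (x y : Eu q) (M : ℝ), (∀ i, |y i| ≤ M) → |h (x + y) - h x| ≤ L * M) → ∀ (v : Fin n → Eu q),
    (∀ j, v j ≠ 0) → (∀ j i, |v j i| ≤ 1) → ∀ x : Eu q,
    |Ex w n (fun b => h (x + (∑ j, ξ (b j) • v j))) -
      Ex w' n (fun b => h (x + (∑ j, ξ' (b j) • v j)))| ≤
      K * L * (q * (1 + Real.log (q * (n + 1)))) := by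
  obtain ⟨K, hK, hlin⟩ := lindeberg
  set m1 := ∫ z : ℝ, |z| ∂stdN with hm1
  have m1n : 0 ≤ m1 := integral_nonneg fun z => abs_nonneg z
  refine ⟨2 * K + 2 * m1, by positivity, ?_⟩
  intro w ξ w' ξ' hw hw' q n hq h hc hb L hL hl v hv0 hv1 x
  have hdir : ∀ j (x : Eu q) (c : ℝ), |h (x + c • v j) - h x| ≤ L * |c| := fun j x c =>
    hl x _ _ fun i => by
      have := hv1 j i
      simp only [PiLp.smul_apply, smul_eq_mul, abs_mul]
      nlinarith [abs_nonneg c]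
  have h1 := hlin w ξ hw q h hc hb L hL n v hv0 hdir x
  have h2 := hlin w' ξ' hw' q h hc hb L hL n v hv0 hdir x
  have s1 := Ex_close w hw.nonneg hw.sum n (fun b => h (x + (∑ j, ξ (b j) • v j)))
    (fun b => ∫ y, h (x + (∑ j, ξ (b j) • v j) + y) ∂gam 1) _
    (fun b => smooth_cost h hc hb L hL hl _)
  have s2 := Ex_close w' hw'.nonneg hw'.sum n (fun b => h (x + (∑ j, ξ' (b j) • v j)))
    (fun b => ∫ y, h (x + (∑ j, ξ' (b j) • v j) + y) ∂gam 1) _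
    (fun b => smooth_cost h hc hb L hL hl _)
  have hd := det_bound v hv1
  rw [← hm1] at s1 s2
  have hlog : 0 ≤ Real.log (q * (n + 1)) := Real.log_nonneg (by
    have : (1:ℝ) ≤ q := by exact_mod_cast hq
    nlinarith [Nat.cast_nonneg (α := ℝ) n])
  have hd' : K * L * Real.log (1 + ∑ j, rk1 (v j)).det ≤ K * L * (q * Real.log (q * (n + 1))) := by
    gcongr
  have p1 : 0 ≤ K * L * q := by positivity
  have p2 : 0 ≤ m1 * L * (q * Real.log (q * (n + 1))) := by positivity
  rw [abs_le] at *
  constructor <;> nlinarith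

lemma centralBinom_sq (m : ℕ) : m.centralBinom ^ 2 * (2 * m + 1) ≤ 16 ^ m := by
  induction m with
  | zero => simp
  | succ m ih =>
    have h := Nat.succ_mul_centralBinom_succ m
    have h2 : (m + 1) ^ 2 * ((m + 1).centralBinom ^ 2 * (2 * (m + 1) + 1)) ≤
        (m + 1) ^ 2 * 16 ^ (m + 1) := by
      calc (m + 1) ^ 2 * ((m + 1).centralBinom ^ 2 * (2 * (m + 1) + 1))
          = ((m + 1) * (m + 1).centralBinom) ^ 2 * (2 * m + 3) := by ring
        _ = (2 * (2 * m + 1) * m.centralBinom) ^ 2 * (2 * m + 3) := by rw [h]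
        _ = (4 * (2 * m + 1) * (2 * m + 3)) * (m.centralBinom ^ 2 * (2 * m + 1)) := by ring
        _ ≤ (16 * (m + 1) ^ 2) * 16 ^ m := by
            refine Nat.mul_le_mul ?_ ih
            nlinarith
        _ = _ := by ring
    exact Nat.le_of_mul_le_mul_left h2 (by positivity)

lemma choose_sq (n k : ℕ) : (n.choose k) ^ 2 * n ≤ 4 ^ n := by
  have h0 := Nat.choose_le_middle k n
  have h1 : (n.choose k) ^ 2 * n ≤ (n.choose (n / 2)) ^ 2 * n := by gcongr
  refine h1.trans ?_
  rcases Nat.even_or_odd' n with ⟨m, rfl | rfl⟩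
  · have h := centralBinom_sq m
    rw [Nat.centralBinom] at h
    have e : 2 * m / 2 = m := by omega
    rw [e, pow_mul]
    norm_num
    nlinarith
  · have h := centralBinom_sq (m + 1)
    have e : (2 * m + 1) / 2 = m := by omega
    have hc : (m + 1).centralBinom = 2 * (2 * m + 1).choose m := by
      rw [Nat.centralBinom, show 2 * (m + 1) = (2 * m + 1) + 1 by ring, Nat.choose_succ_succ,
        Nat.choose_symm_half]
      ring
    rw [hc] at h
    have e4 : 4 ^ (2 * m + 1) = 4 * 16 ^ m := by
      rw [pow_succ, pow_mul]; norm_num; ring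
    have e5 : 16 ^ (m + 1) = 16 * 16 ^ m := by rw [pow_succ]; ring
    rw [e, e4]
    rw [e5] at h
    nlinarith [sq_nonneg ((2 * m + 1).choose m)]

lemma choose_bound (n k : ℕ) (hn : 1 ≤ n) : ((1 : ℝ) / 2) ^ n * (n.choose k) ≤ 1 / Real.sqrt n := by
  have hn' : (0 : ℝ) < n := by exact_mod_cast hn
  have h : ((n.choose k : ℝ)) ^ 2 * n ≤ 4 ^ n := by exact_mod_cast choose_sq n k
  have hs : 0 < Real.sqrt n := Real.sqrt_pos.mpr hn'
  rw [le_div_iff₀ hs]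
  refine abs_le_of_sq_le_sq' (a := ((1 : ℝ) / 2) ^ n * (n.choose k) * Real.sqrt n) (b := 1) ?_
    zero_le_one |>.2
  rw [mul_pow, mul_pow, Real.sq_sqrt hn'.le, ← pow_mul, mul_comm n 2, pow_mul]
  have : ((1 / 2 : ℝ) ^ 2) ^ n * 4 ^ n = 1 := by
    rw [← mul_pow]; norm_num
  nlinarith [pow_pos (show (0 : ℝ) < (1 / 2) ^ 2 by norm_num) n]

lemma card_window (N : ℕ) (A r : ℝ) (hr : 0 ≤ r) :
    (((Finset.range N).filter (fun k : ℕ => |A + 2 * (k : ℝ)| < r)).card : ℝ) ≤ r + 1 := by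
  set F := (Finset.range N).filter (fun k : ℕ => |A + 2 * (k : ℝ)| < r) with hF
  rcases F.eq_empty_or_nonempty with h | h
  · rw [h]; simp; linarith
  · have hsub : F ⊆ Finset.Icc (F.min' h) (F.max' h) := fun k hk =>
      Finset.mem_Icc.mpr ⟨F.min'_le k hk, F.le_max' k hk⟩
    have hc := Finset.card_le_card hsub
    rw [Nat.card_Icc] at hc
    have h1 := (Finset.mem_filter.mp (F.min'_mem h)).2
    have h2 := (Finset.mem_filter.mp (F.max'_mem h)).2
    have hle : F.min' h ≤ F.max' h := F.min'_le_max' h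
    rw [abs_lt] at h1 h2
    have hc' : F.card + F.min' h ≤ F.max' h + 1 := by omega
    have hc'' : (F.card : ℝ) + (F.min' h : ℝ) ≤ (F.max' h : ℝ) + 1 := by exact_mod_cast hc'
    linarith

/-- Reindexing sign vectors by the set where they agree with `ε`. -/
def agreeEquiv {n : ℕ} (ε : Fin n → Bool) : (Fin n → Bool) ≃ Finset (Fin n) where
  toFun b := Finset.univ.filter (fun j => ε j = b j)
  invFun s := fun j => if j ∈ s then ε j else !ε j
  left_inv b := by
    ext j
    by_cases h : ε j = b j
    · simp [h]
    · simp only [Finset.mem_filter, Finset.mem_univ, true_and, h, if_false]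
      cases h1 : ε j <;> cases h2 : b j <;> simp_all
  right_inv s := by
    ext j
    by_cases h : j ∈ s <;> simp [h]

lemma sum_pm {n : ℕ} (ε b : Fin n → Bool) :
    ∑ j, pm (ε j) * pm (b j) = 2 * ((agreeEquiv ε b).card : ℝ) - n := by
  have h : ∀ j, pm (ε j) * pm (b j) = 2 * (if ε j = b j then (1:ℝ) else 0) - 1 := by
    intro j
    cases ε j <;> cases b j <;> simp [pm] <;> norm_num
  simp only [h, Finset.sum_sub_distrib, ← Finset.mul_sum]
  simp [agreeEquiv]

lemma anticonc {n : ℕ} (hn : 1 ≤ n) (ε : Fin n → Bool) (A r : ℝ) (hr : 0 ≤ r) :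
    Ex (fun _ => 1 / 2) n (fun b => if |A + ∑ j, pm (ε j) * pm (b j)| < r then 1 else 0) ≤
      (r + 1) / Real.sqrt n := by
  unfold Ex
  simp only [sum_pm, Finset.prod_const, Finset.card_univ, Fintype.card_fin]
  rw [(agreeEquiv ε).sum_comp (fun s : Finset (Fin n) => ((1 : ℝ) / 2) ^ n *
    (if |A + (2 * (s.card : ℝ) - n)| < r then 1 else 0)), ← Finset.powerset_univ,
    Finset.sum_powerset_apply_card (fun k : ℕ => ((1 : ℝ) / 2) ^ n *
    (if |A + (2 * (k : ℝ) - n)| < r then 1 else 0))]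
  simp only [Finset.card_univ, Fintype.card_fin, nsmul_eq_mul]
  have hn' : (0 : ℝ) < n := by exact_mod_cast hn
  calc _ ≤ ∑ m ∈ Finset.range (n + 1), (1 / Real.sqrt n) *
        (if |(A - n) + 2 * (m : ℝ)| < r then 1 else 0) := by
        refine Finset.sum_le_sum fun m _ => ?_
        have e : A + (2 * (m : ℝ) - n) = (A - n) + 2 * m := by ring
        rw [e, ← mul_assoc, mul_comm ((n.choose m : ℝ))]
        refine mul_le_mul_of_nonneg_right (choose_bound n m hn) ?_
        split_ifs <;> simp
    _ = (1 / Real.sqrt n) * (((Finset.range (n + 1)).filter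
          (fun k : ℕ => |(A - n) + 2 * (k : ℝ)| < r)).card : ℝ) := by
        rw [← Finset.mul_sum, Finset.sum_boole]
    _ ≤ (1 / Real.sqrt n) * (r + 1) := by
        gcongr; exact card_window _ _ _ hr
    _ = _ := by ring

/-- Membership depends only on signs of coordinates. -/
def SignDet {q : ℕ} (O : Set (Fin q → ℝ)) : Prop :=
  ∀ x y : Fin q → ℝ, (∀ i, 0 ≤ x i ↔ 0 ≤ y i) → (x ∈ O → y ∈ O)

lemma signDet_of_union {q : ℕ} {O : Set (Fin q → ℝ)} (h : IsUnionOfOrthants O) : SignDet O := by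
  obtain ⟨S₀, rfl⟩ := h
  intro x y hxy hx
  simp only [Set.mem_iUnion] at hx ⊢
  obtain ⟨s, hs, hx⟩ := hx
  refine ⟨s, hs, fun i => ?_⟩
  have := hx i
  have h2 := hxy i
  split_ifs with hsi
  · rw [if_pos hsi] at this; exact h2.mp this
  · rw [if_neg hsi] at this; exact not_le.mp fun h => absurd (h2.mpr h) (not_le.mpr this)

lemma SignDet.compl {q : ℕ} {O : Set (Fin q → ℝ)} (h : SignDet O) : SignDet Oᶜ :=
  fun x y hxy hx hy => hx (h y x (fun i => (hxy i).symm) hy)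

/-- Lipschitz majorant of the indicator of `O`. -/
noncomputable def maj {q : ℕ} (O : Set (Fin q → ℝ)) (r : ℝ) (x : Eu q) : ℝ :=
  max 0 (1 - Metric.infDist (WithLp.ofLp x) O / r)

lemma maj_nonneg {q : ℕ} (O : Set (Fin q → ℝ)) (r : ℝ) (x : Eu q) : 0 ≤ maj O r x :=
  le_max_left _ _

lemma maj_le_one {q : ℕ} (O : Set (Fin q → ℝ)) (r : ℝ) (hr : 0 < r) (x : Eu q) :
    maj O r x ≤ 1 := by
  refine max_le zero_le_one ?_
  have : 0 ≤ Metric.infDist (WithLp.ofLp x) O / r := div_nonneg Metric.infDist_nonneg hr.le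
  linarith

lemma maj_mem {q : ℕ} (O : Set (Fin q → ℝ)) (r : ℝ) (x : Eu q) (hx : WithLp.ofLp x ∈ O) :
    1 ≤ maj O r x := by
  unfold maj
  rw [Metric.infDist_zero_of_mem hx]; simp

lemma maj_cont {q : ℕ} (O : Set (Fin q → ℝ)) (r : ℝ) : Continuous (maj O r) := by
  unfold maj
  have h1 : Continuous fun x : Eu q => Metric.infDist (WithLp.ofLp x) O :=
    (Metric.continuous_infDist_pt O).comp (PiLp.continuous_ofLp 2 _)
  fun_prop

lemma maj_lip {q : ℕ} (O : Set (Fin q → ℝ)) (r : ℝ) (hr : 0 < r) (hq : 1 ≤ q) (x y : Eu q) (M : ℝ)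
    (hM : ∀ i, |y i| ≤ M) : |maj O r (x + y) - maj O r x| ≤ 1 / r * M := by
  have hM0 : 0 ≤ M := (abs_nonneg _).trans (hM ⟨0, hq⟩)
  have hd : dist (WithLp.ofLp (x + y)) (WithLp.ofLp x) ≤ M := by
    rw [dist_pi_le_iff hM0]
    intro i
    rw [Real.dist_eq]
    simpa using hM i
  have h1 := Metric.infDist_le_infDist_add_dist (s := O) (x := WithLp.ofLp (x + y))
    (y := WithLp.ofLp x)
  have h2 := Metric.infDist_le_infDist_add_dist (s := O) (x := WithLp.ofLp x)
    (y := WithLp.ofLp (x + y))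
  rw [dist_comm] at h2
  unfold maj
  rw [max_comm 0, max_comm 0]
  refine (abs_max_sub_max_le_abs _ _ _).trans ?_
  set a := Metric.infDist (WithLp.ofLp (x + y)) O
  set b := Metric.infDist (WithLp.ofLp x) O
  have e : (1 - a / r) - (1 - b / r) = 1 / r * (b - a) := by ring
  rw [e, abs_mul, abs_of_pos (by positivity)]
  gcongr
  rw [abs_le]; constructor <;> linarith

open Classical in
lemma maj_le {q : ℕ} (O : Set (Fin q → ℝ)) (hO : SignDet O) (hne : O.Nonempty) (r : ℝ) (hr : 0 < r)
    (x : Eu q) : maj O r x ≤ (if WithLp.ofLp x ∈ O then 1 else 0) +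
      ∑ i, (if |x i| < r then (1 : ℝ) else 0) := by
  have hs : 0 ≤ ∑ i, (if |x i| < r then (1 : ℝ) else 0) :=
    Finset.sum_nonneg fun i _ => by split_ifs <;> simp
  by_cases hx : WithLp.ofLp x ∈ O
  · rw [if_pos hx]; linarith [maj_le_one O r hr x]
  · rw [if_neg hx, zero_add]
    by_cases hd : Metric.infDist (WithLp.ofLp x) O < r
    · obtain ⟨y, hy, hxy⟩ := (Metric.infDist_lt_iff hne).mp hd
      have : ∃ i, |x i| < r := by
        by_contra hcon
        push Not at hcon
        refine hx (hO y _ (fun i => ?_) hy)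
        have h1 := hcon i
        have h2 : |x i - y i| < r := by
          have := (dist_le_pi_dist (WithLp.ofLp x) y i).trans_lt hxy
          rwa [Real.dist_eq] at this
        rw [abs_lt] at h2
        rcases le_abs.mp h1 with h | h
        · constructor <;> intro _ <;> linarith
        · constructor <;> intro _ <;> linarith
      obtain ⟨i, hi⟩ := this
      refine (maj_le_one O r hr x).trans ?_
      have := Finset.single_le_sum (f := fun i => if |x i| < r then (1 : ℝ) else 0)
        (fun i _ => by split_ifs <;> simp) (Finset.mem_univ i)
      simpa [hi] using this
    · push Not at hd
      have : maj O r x = 0 := by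
        unfold maj
        refine max_eq_left ?_
        have : 1 ≤ Metric.infDist (WithLp.ofLp x) O / r := (one_le_div hr).mpr hd
        linarith
      rw [this]; exact hs

/-- Weights of the second distribution. -/
noncomputable def wT (b : Bool) : ℝ := if b then 9 / 10 else 1 / 10
/-- Centered values of the second distribution. -/
noncomputable def xT (b : Bool) : ℝ := if b then 1 / 3 else -3

lemma twoPtT : TwoPt wT xT := by
  constructor
  · intro b; cases b <;> norm_num [wT]
  · norm_num [wT]
  · norm_num [wT, xT]
  · norm_num [wT, xT]
  · intro b; cases b <;> norm_num [xT, abs_of_pos]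

lemma twoPtS : TwoPt (fun _ => 1 / 2) pm := by
  constructor
  · intro b; norm_num
  · norm_num
  · norm_num [pm]
  · norm_num [pm]
  · intro b; cases b <;> norm_num [pm]

/-- Sample vector in terms of the centered values. -/
noncomputable def vecOf {q n : ℕ} (Q : Fin q → Fin n → Bool) (ξ : Bool → ℝ) (b : Fin n → Bool) :
    Fin q → ℝ := fun i => ∑ j, pm (Q i j) * (2 + ξ (b j))

/-- Columns of the matrix. -/
noncomputable def colOf {q n : ℕ} (Q : Fin q → Fin n → Bool) (j : Fin n) : Eu q :=
  WithLp.toLp 2 (fun i => pm (Q i j))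

/-- Mean vector. -/
noncomputable def meanOf {q n : ℕ} (Q : Fin q → Fin n → Bool) : Eu q :=
  WithLp.toLp 2 (fun i => ∑ j, pm (Q i j) * 2)

lemma vecOf_eq {q n : ℕ} (Q : Fin q → Fin n → Bool) (ξ : Bool → ℝ) (b : Fin n → Bool) :
    WithLp.ofLp (meanOf Q + ∑ j, ξ (b j) • colOf Q j) = vecOf Q ξ b := by
  ext i
  simp only [meanOf, colOf, vecOf, mul_add, Finset.sum_add_distrib]
  simp [WithLp.ofLp_sum, mul_comm]

lemma abs_pm (b : Bool) : |pm b| = 1 := by cases b <;> simp [pm]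

open Classical in
lemma one_sided : ∃ K : ℝ, 0 < K ∧ ∀ q n : ℕ, 1 ≤ q → 1 ≤ n → ∀ Q : Fin q → Fin n → Bool,
    ∀ O : Set (Fin q → ℝ), SignDet O → ∀ r : ℝ, 0 < r →
    Ex wT n (fun b => if vecOf Q xT b ∈ O then 1 else 0) -
      Ex (fun _ => 1 / 2) n (fun b => if vecOf Q pm b ∈ O then 1 else 0) ≤
      K * (1 / r) * (q * (1 + Real.log (q * (n + 1)))) + q * ((r + 1) / Real.sqrt n) := by
  obtain ⟨K, hK, hW⟩ := wass
  refine ⟨K, hK, ?_⟩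
  intro q n hq hn Q O hO r hr
  have hlog : 0 ≤ Real.log (q * (n + 1)) := Real.log_nonneg (by
    have : (1:ℝ) ≤ q := by exact_mod_cast hq
    nlinarith [Nat.cast_nonneg (α := ℝ) n])
  rcases O.eq_empty_or_nonempty with rfl | hne
  · simp only [Set.mem_empty_iff_false, if_false]
    have : ∀ w, Ex w n (fun _ => (0:ℝ)) = 0 := fun w => by simp [Ex]
    rw [this, this, sub_zero]
    positivity
  have hw := hW wT xT (fun _ => 1 / 2) pm twoPtT twoPtS q n hq (maj O r) (maj_cont O r)
    (fun x => by rw [abs_of_nonneg (maj_nonneg O r x)]; exact maj_le_one O r hr x) (1 / r)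
    (by positivity) (maj_lip O r hr hq) (colOf Q)
    (fun j h => by
      have := congrArg (fun x : Eu q => |x ⟨0, hq⟩|) h
      simp [colOf, abs_pm] at this)
    (fun j i => by simp [colOf, abs_pm]) (meanOf Q)
  have h1 : Ex wT n (fun b => if vecOf Q xT b ∈ O then 1 else 0) ≤
      Ex wT n (fun b => maj O r (meanOf Q + ∑ j, xT (b j) • colOf Q j)) := by
    refine Ex_mono _ twoPtT.nonneg _ _ _ fun b => ?_
    split_ifs with h
    · exact maj_mem O r _ (by rw [vecOf_eq]; exact h)
    · exact maj_nonneg O r _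
  have h2 : Ex (fun _ => 1 / 2) n (fun b => maj O r (meanOf Q + ∑ j, pm (b j) • colOf Q j)) ≤
      Ex (fun _ => 1 / 2) n (fun b => (if vecOf Q pm b ∈ O then 1 else 0) +
        ∑ i, (if |(∑ j, pm (Q i j) * 2) + ∑ j, pm (Q i j) * pm (b j)| < r then (1:ℝ) else 0)) := by
    refine Ex_mono _ twoPtS.nonneg _ _ _ fun b => ?_
    refine (maj_le O hO hne r hr _).trans (le_of_eq ?_)
    rw [vecOf_eq]
    congr 1
    refine Finset.sum_congr rfl fun i _ => ?_
    have : vecOf Q pm b i =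
        (∑ j, pm (Q i j) * 2) + ∑ j, pm (Q i j) * pm (b j) := by
      simp only [vecOf, mul_add, Finset.sum_add_distrib]
    rw [this]
  rw [Ex_add, Ex_sum] at h2
  have h3 : ∑ i, Ex (fun _ => 1 / 2) n (fun b =>
      if |(∑ j, pm (Q i j) * 2) + ∑ j, pm (Q i j) * pm (b j)| < r then (1:ℝ) else 0) ≤
      q * ((r + 1) / Real.sqrt n) := by
    refine (Finset.sum_le_sum fun i _ => anticonc hn (Q i) _ r hr.le).trans ?_
    simp
  have := (abs_le.mp hw).2
  linarith

lemma Ex_compl (w : Bool → ℝ) (hs : w true + w false = 1) (n : ℕ) (P : (Fin n → Bool) → Prop)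
    [∀ b, Decidable (P b)] [∀ b, Decidable (¬ P b)] :
    Ex w n (fun b => if ¬ P b then 1 else 0) = 1 - Ex w n (fun b => if P b then 1 else 0) := by
  have h : Ex w n (fun b => (if ¬ P b then 1 else 0) + (if P b then 1 else 0)) = 1 := by
    have e : (fun b => (if ¬ P b then (1:ℝ) else 0) + (if P b then 1 else 0)) = fun _ => 1 := by
      ext b
      by_cases hb : P b <;> simp [hb]
    rw [e]; exact Ex_sum_one w hs n
  rw [Ex_add] at h
  linarith

open Classical in
lemma two_sided : ∃ K : ℝ, 0 < K ∧ ∀ q n : ℕ, 1 ≤ q → 1 ≤ n → ∀ Q : Fin q → Fin n → Bool,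
    ∀ O : Set (Fin q → ℝ), SignDet O → ∀ r : ℝ, 0 < r →
    |Ex (fun _ => 1 / 2) n (fun b => if vecOf Q pm b ∈ O then 1 else 0) -
      Ex wT n (fun b => if vecOf Q xT b ∈ O then 1 else 0)| ≤
      K * (1 / r) * (q * (1 + Real.log (q * (n + 1)))) + q * ((r + 1) / Real.sqrt n) := by
  obtain ⟨K, hK, h⟩ := one_sided
  refine ⟨K, hK, fun q n hq hn Q O hO r hr => ?_⟩
  have h1 := h q n hq hn Q O hO r hr
  have h2 := h q n hq hn Q Oᶜ hO.compl r hr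
  simp only [Set.mem_compl_iff] at h2
  rw [Ex_compl _ twoPtT.sum, Ex_compl _ twoPtS.sum] at h2
  rw [abs_le]; constructor <;> linarith

lemma Ex_bool_mem (w : Bool → ℝ) (hw : ∀ b, 0 ≤ w b) (hs : w true + w false = 1) (n : ℕ)
    (P : (Fin n → Bool) → Prop) [∀ b, Decidable (P b)] :
    0 ≤ Ex w n (fun b => if P b then 1 else 0) ∧ Ex w n (fun b => if P b then 1 else 0) ≤ 1 := by
  constructor
  · calc (0:ℝ) = Ex w n (fun _ => 0) := (Ex_const w hs n 0).symm
      _ ≤ _ := Ex_mono w hw n _ _ fun b => by split_ifs <;> simp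
  · calc _ ≤ Ex w n (fun _ => 1) := Ex_mono w hw n _ _ fun b => by split_ifs <;> simp
      _ = 1 := Ex_sum_one w hs n

lemma numeric (K : ℝ) (hK : 0 < K) (q n : ℕ) (hq : 1 ≤ q) (hn : 2 ≤ n) (D : ℝ) (hD1 : D ≤ 1)
    (hD : ∀ r : ℝ, 0 < r → D ≤ K * (1 / r) * (q * (1 + Real.log (q * (n + 1)))) +
      q * ((r + 1) / Real.sqrt n)) :
    D ≤ (5 * K + 3) * (q : ℝ) ^ ((5 : ℝ)/4) * (Real.log n) ^ ((1 : ℝ)/2) /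
      (n : ℝ) ^ ((1 : ℝ)/4) := by
  have hn2 : (2 : ℝ) ≤ n := by exact_mod_cast hn
  have hq1 : (1 : ℝ) ≤ q := by exact_mod_cast hq
  have hn0 : (0 : ℝ) < n := by linarith
  have hl2 : (0.69 : ℝ) ≤ Real.log n := by
    have h1 := Real.log_two_gt_d9
    have h2 := Real.log_le_log (by norm_num) hn2
    linarith
  have hl0 : (0 : ℝ) < Real.log n := by linarith
  set a := (n : ℝ) ^ ((1 : ℝ) / 4) with ha
  set s := (Real.log n) ^ ((1 : ℝ) / 2) with hs
  have ha0 : 0 < a := Real.rpow_pos_of_pos hn0 _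
  have hs0 : 0 < s := Real.rpow_pos_of_pos hl0 _
  have hs2 : s ^ 2 = Real.log n := by
    rw [hs, ← Real.sqrt_eq_rpow, Real.sq_sqrt hl0.le]
  have ha2 : a ^ 2 = Real.sqrt n := by
    rw [ha, Real.sqrt_eq_rpow, ← Real.rpow_natCast, ← Real.rpow_mul hn0.le]
    norm_num
  have ha1 : 1 ≤ a := Real.one_le_rpow (by linarith) (by norm_num)
  have han : a ≤ n := by
    calc a ≤ (n : ℝ) ^ (1 : ℝ) := Real.rpow_le_rpow_of_exponent_le (by linarith) (by norm_num)
      _ = n := Real.rpow_one _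
  have hsh : 1 / 2 ≤ s := by
    by_contra hcon
    push Not at hcon
    nlinarith
  have hqq : (q : ℝ) ≤ (q : ℝ) ^ ((5 : ℝ) / 4) := by
    calc (q : ℝ) = (q : ℝ) ^ (1 : ℝ) := (Real.rpow_one _).symm
      _ ≤ _ := Real.rpow_le_rpow_of_exponent_le hq1 (by norm_num)
  have main : D ≤ (5 * K + 3) * q * s / a := by
    by_cases hqn : n ≤ q
    · refine hD1.trans ?_
      rw [le_div_iff₀ ha0]
      have hqn' : (n : ℝ) ≤ q := by exact_mod_cast hqn
      have : a ≤ q := han.trans hqn'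
      have h3 : 3 * (q : ℝ) * (1 / 2) ≤ (5 * K + 3) * q * s := by
        gcongr; linarith
      linarith
    · push Not at hqn
      have hqn' : (q : ℝ) ≤ n := by exact_mod_cast hqn.le
      have h := hD (s * a) (by positivity)
      have hlog : Real.log (q * (n + 1)) ≤ 3 * Real.log n := by
        have : Real.log ((n : ℝ) ^ 3) = 3 * Real.log n := by
          rw [Real.log_pow]; norm_num
        rw [← this]
        refine Real.log_le_log (by positivity) ?_
        calc (q : ℝ) * (n + 1) ≤ n * (n * n) := by
              gcongr; nlinarith
          _ = _ := by ring
      have e1 : 1 + Real.log (q * (n + 1)) ≤ 5 * s ^ 2 := by rw [hs2]; linarith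
      have e2 : s * a + 1 ≤ 3 * (s * a) := by nlinarith
      refine h.trans ?_
      rw [← ha2]
      calc K * (1 / (s * a)) * (q * (1 + Real.log (q * (n + 1)))) + q * ((s * a + 1) / a ^ 2)
          ≤ K * (1 / (s * a)) * (q * (5 * s ^ 2)) + q * (3 * (s * a) / a ^ 2) := by gcongr
        _ = _ := by field_simp
  refine main.trans ?_
  gcongr

open Classical in
theorem S_T_orthant_closeness :
    ∃ C : ℝ, 0 < C ∧ ∀ q n : ℕ, 1 ≤ q → 2 ≤ n →
      ∀ Q : Fin q → Fin n → Bool, ∀ O : Set (Fin q → ℝ), IsUnionOfOrthants O →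
        |(∑ s : Fin n → Bool, ((1 : ℝ)/2) ^ n *
            (if (fun i => ∑ j : Fin n, pm (Q i j) * (if s j then (3 : ℝ) else 1)) ∈ O
              then 1 else 0)) -
         (∑ b : Fin n → Bool, (∏ j : Fin n, if b j then (9 : ℝ)/10 else 1/10) *
            (if (fun i => ∑ j : Fin n, pm (Q i j) * (if b j then (7 : ℝ)/3 else -1)) ∈ O
              then 1 else 0))| ≤
          C * (q : ℝ) ^ ((5 : ℝ)/4) * (Real.log n) ^ ((1 : ℝ)/2) / (n : ℝ) ^ ((1 : ℝ)/4) := by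
  obtain ⟨K, hK, h⟩ := two_sided
  refine ⟨5 * K + 3, by positivity, fun q n hq hn Q O hO => ?_⟩
  have hS : (∑ s : Fin n → Bool, ((1 : ℝ)/2) ^ n *
            (if (fun i => ∑ j : Fin n, pm (Q i j) * (if s j then (3 : ℝ) else 1)) ∈ O
              then 1 else 0)) =
      Ex (fun _ => 1 / 2) n (fun b => if vecOf Q pm b ∈ O then 1 else 0) := by
    unfold Ex
    refine Finset.sum_congr rfl fun b _ => ?_
    have e : (fun i => ∑ j : Fin n, pm (Q i j) * (if b j then (3 : ℝ) else 1)) = vecOf Q pm b := by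
      ext i
      refine Finset.sum_congr rfl fun j _ => ?_
      cases b j <;> norm_num [pm]
    rw [e]
    simp
  have hT : (∑ b : Fin n → Bool, (∏ j : Fin n, if b j then (9 : ℝ)/10 else 1/10) *
            (if (fun i => ∑ j : Fin n, pm (Q i j) * (if b j then (7 : ℝ)/3 else -1)) ∈ O
              then 1 else 0)) =
      Ex wT n (fun b => if vecOf Q xT b ∈ O then 1 else 0) := by
    unfold Ex
    refine Finset.sum_congr rfl fun b _ => ?_
    have e : (fun i => ∑ j : Fin n, pm (Q i j) * (if b j then (7 : ℝ)/3 else -1)) =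
        vecOf Q xT b := by
      ext i
      refine Finset.sum_congr rfl fun j _ => ?_
      cases b j <;> norm_num [xT]
    rw [e]
    rfl
  rw [hS, hT]
  refine numeric K hK q n hq hn _ ?_ fun r hr =>
    h q n hq (by omega) Q O (signDet_of_union hO) r hr
  have h1 := Ex_bool_mem (fun _ => 1 / 2) twoPtS.nonneg twoPtS.sum n (fun b => vecOf Q pm b ∈ O)
  have h2 := Ex_bool_mem wT twoPtT.nonneg twoPtT.sum n (fun b => vecOf Q xT b ∈ O)
  rw [abs_le]; constructor <;> linarith [h1.1, h1.2, h2.1, h2.2]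
end

section
/- Let m ≥ 2 be an even integer and define, for each f : {−1,1}^n → {−1,1}, the function Φ[f] : [m]^n → {−1,1} by Φ[f](x₁,…,xₙ) = f(ι[x₁ > m/2],…,ι[xₙ > m/2]), where ι[P] = 1 if P is true and −1 otherwise. Then: (1) if f is monotone then Φ[f] is monotone; and (2) for every ε > 0, if f is ε-far from monotone then Φ[f] is ε-far from monotone. -/
open Finset

/-- `f` is monotone (as a `{-1,1}`-valued function, identifying `false ↦ -1`, `true ↦ 1`;
the domain is ordered coordinatewise). -/
def IsMono {α : Type*} [Preorder α] (f : α → Bool) : Prop :=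
  ∀ x y : α, x ≤ y → f x ≤ f y

/-- Normalized Hamming distance between two functions on a finite domain. -/
noncomputable def distB {α : Type*} [Fintype α] (f g : α → Bool) : ℝ :=
  ((Finset.univ.filter (fun x => f x ≠ g x)).card : ℝ) / (Fintype.card α : ℝ)

/-- `f` is `ε`-far from monotone. -/
def FarFromMono {α : Type*} [Fintype α] [Preorder α] (ε : ℝ) (f : α → Bool) : Prop :=
  ∀ g : α → Bool, IsMono g → ε < distB f g

/-- The map `Φ` sending `f : {-1,1}^n → {-1,1}` to `Φ[f] : [m]^n → {-1,1}` defined by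
`Φ[f](x₁,…,xₙ) = f(ι[x₁ > m/2],…,ι[xₙ > m/2])`.  Here `[m] = {1,…,m}` is encoded by
`Fin m` via `v ↦ v + 1`, so the coordinate value is `(x i : ℕ) + 1`. -/
def PhiEven {n m : ℕ} (f : (Fin n → Bool) → Bool) : (Fin n → Fin m) → Bool :=
  fun x => f (fun i => decide (m / 2 < (x i : ℕ) + 1))

/-- The point of the subcube with offset `r` indexed by the Boolean vector `b`. -/
def cubePt {n k : ℕ} (b : Fin n → Bool) (r : Fin n → Fin k) : Fin n → Fin (k + k) :=
  fun i => ⟨(r i : ℕ) + (if b i then k else 0), by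
    have := (r i).isLt
    split_ifs <;> omega⟩

theorem cubePt_mono {n k : ℕ} (r : Fin n → Fin k) (b c : Fin n → Bool) (h : b ≤ c) :
    cubePt b r ≤ cubePt c r := by
  intro i
  have hi := h i
  rw [Fin.le_def]
  simp only [cubePt]
  rw [Bool.le_iff_imp] at hi
  cases hb : b i <;> cases hc : c i <;> simp_all

theorem phi_cubePt {n k : ℕ} (f : (Fin n → Bool) → Bool) (b : Fin n → Bool)
    (r : Fin n → Fin k) : PhiEven f (cubePt b r) = f b := by
  unfold PhiEven
  congr 1
  funext i
  have := (r i).isLt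
  simp only [cubePt]
  rcases Bool.eq_false_or_eq_true (b i) with hb | hb
  · simp [hb]; omega
  · simp [hb]; omega

theorem cubePt_bij (n k : ℕ) : Function.Bijective
    (fun p : (Fin n → Fin k) × (Fin n → Bool) => cubePt p.2 p.1) := by
  rw [Fintype.bijective_iff_injective_and_card]
  constructor
  · rintro ⟨r, b⟩ ⟨s, c⟩ h
    have key : ∀ i, r i = s i ∧ b i = c i := by
      intro i
      have h1 := congrArg Fin.val (congrFun h i)
      have := (r i).isLt
      have := (s i).isLt
      simp only [cubePt] at h1
      rw [Fin.ext_iff]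
      cases hb : b i <;> cases hc : c i <;> simp [hb, hc] at h1 ⊢ <;> omega
    exact Prod.ext (funext fun i => (key i).1) (funext fun i => (key i).2)
  · simp [← mul_pow, mul_two]

theorem hypergrid_reduction_even :
    ∀ n m : ℕ, 2 ≤ m → Even m → ∀ f : (Fin n → Bool) → Bool,
      (IsMono f → IsMono (PhiEven (m := m) f)) ∧
      (∀ ε : ℝ, 0 < ε → FarFromMono ε f → FarFromMono ε (PhiEven (m := m) f)) := by
  rintro n m hm ⟨k, rfl⟩ f
  refine ⟨?_, ?_⟩
  · intro hf x y hxy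
    refine hf _ _ fun i => ?_
    have h : (x i : ℕ) ≤ (y i : ℕ) := hxy i
    rw [Bool.le_iff_imp]
    simp only [decide_eq_true_eq]
    omega
  · intro ε _ hf g hg
    have hk : 0 < k := by omega
    haveI : Nonempty (Fin k) := ⟨⟨0, hk⟩⟩
    have hcount : ((univ.filter (fun x => PhiEven (m := k + k) f x ≠ g x)).card : ℝ)
        = ∑ r : Fin n → Fin k,
          ((univ.filter (fun b => f b ≠ g (cubePt b r))).card : ℝ) := by
      simp only [Finset.card_filter]
      push_cast
      rw [← (cubePt_bij n k).sum_comp, Fintype.sum_prod_type]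
      simp only [phi_cubePt]
    have hr : ∀ r : Fin n → Fin k, ε * 2 ^ n <
        ((univ.filter (fun b => f b ≠ g (cubePt b r))).card : ℝ) := by
      intro r
      have h := hf (fun b => g (cubePt b r)) (fun b c hbc => hg _ _ (cubePt_mono r b c hbc))
      unfold distB at h
      rw [lt_div_iff₀ (by exact_mod_cast Fintype.card_pos)] at h
      simpa using h
    have hsum := Finset.sum_lt_sum_of_nonempty
      (Finset.univ_nonempty (α := Fin n → Fin k)) (fun r _ => hr r)
    rw [← hcount] at hsum
    have hpos : (0 : ℝ) < (k : ℝ) + k := by positivity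
    unfold distB
    rw [lt_div_iff₀ (by simp; positivity)]
    refine lt_of_eq_of_lt ?_ hsum
    simp
    rw [← two_mul, mul_pow]
    ring
end
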